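/- Let L = {p ∈ ℝ³ : p₁ = p₂ = 0} be the z-axis and Ω = ℝ³ \ L. Let σ : ℝ³ → ℝ be continuous on Ω and suppose: (i) 0 ≤ σ(p) ≤ M for some constant M and all p ∈ Ω; (ii) σ(p) → 0 as ‖p‖ → ∞; (iii) σ is subharmonic on Ω in the distributional sense, i.e. for every smooth φ : ℝ³ → ℝ with compact support contained in Ω and φ ≥ 0 one has ∫_{ℝ³} σ(p)·Δφ(p) dp ≥ 0. Then σ(p) = 0 for all p ∈ Ω. (This is Weinstein's lemma; the decay at infinity, which holds in the paper's application, is needed for the conclusion.) -/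

import Mathlib

open MeasureTheory

/-- The Laplacian of a function on Euclidean space: the sum of its second
partial derivatives along the standard basis directions. -/
noncomputable def laplacian {n : ℕ} (f : EuclideanSpace ℝ (Fin n) → ℝ)
    (x : EuclideanSpace ℝ (Fin n)) : ℝ :=
  ∑ i : Fin n,
    fderiv ℝ (fderiv ℝ f) x (EuclideanSpace.single i 1) (EuclideanSpace.single i 1)

open scoped Convolution

theorem nonpos_of_isLocalMax_of_hasDerivAt {h h' : ℝ → ℝ} {c t : ℝ}
    (hh : ∀ᶠ s in nhds t, HasDerivAt h (h' s) s) (hh' : HasDerivAt h' c t)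
    (hmax : IsLocalMax h t) : c ≤ 0 := by
  by_contra! hc
  have hd : deriv h =ᶠ[nhds t] h' := hh.mono fun s hs => hs.deriv
  have hdd : deriv (deriv h) t = c := hd.deriv_eq.trans hh'.deriv
  have hmin : IsLocalMin h t := isLocalMin_of_deriv_deriv_pos (by rw [hdd]; exact hc)
    hmax.deriv_eq_zero hh.self_of_nhds.continuousAt
  have hconst : h =ᶠ[nhds t] fun _ => h t := by
    filter_upwards [hmax, hmin] with s h1 h2 using le_antisymm h1 h2
  have hzero : deriv (deriv h) t = 0 := by
    rw [hconst.deriv.deriv_eq]; simp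
  linarith

section Convolution

variable {E : Type*} [NormedAddCommGroup E] [NormedSpace ℝ E] [MeasurableSpace E] [BorelSpace E]
  {μ : Measure E} [FiniteDimensional ℝ E] [μ.IsAddHaarMeasure]

theorem fderiv_convolution_lsmul_apply
    {k g : E → ℝ} (hk : ContDiff ℝ 1 k) (hck : HasCompactSupport k)
    (hg : LocallyIntegrable g μ) (x v : E) :
    fderiv ℝ (k ⋆[ContinuousLinearMap.lsmul ℝ ℝ, μ] g : E → ℝ) x v =
      ((fderiv ℝ k · v) ⋆[ContinuousLinearMap.lsmul ℝ ℝ, μ] g : E → ℝ) x := by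
  rw [(hck.hasFDerivAt_convolution_left (ContinuousLinearMap.lsmul ℝ ℝ) hk hg x).fderiv]
  have := (hck.fderiv ℝ).convolutionExists_left
    ((ContinuousLinearMap.lsmul ℝ ℝ).precompL E) (hk.continuous_fderiv one_ne_zero) hg x
  simp_rw [convolution_def, ContinuousLinearMap.integral_apply this]
  rfl

end Convolution

theorem laplacian_eq_sum_fderiv_fderiv_apply {n : ℕ} {f : EuclideanSpace ℝ (Fin n) → ℝ}
    (hf : ContDiff ℝ 2 f) (x : EuclideanSpace ℝ (Fin n)) :
    laplacian f x = ∑ i, fderiv ℝ (fun y => fderiv ℝ f y (EuclideanSpace.single i 1)) x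
      (EuclideanSpace.single i 1) := by
  refine Finset.sum_congr rfl fun i _ => ?_
  have h : DifferentiableAt ℝ (fderiv ℝ f) x :=
    (hf.fderiv_right (m := 1) (by norm_num)).differentiable one_ne_zero x
  rw [fderiv_clm_apply h (differentiableAt_const _)]
  simp

theorem fderiv_comp_const_sub_apply {E : Type*} [NormedAddCommGroup E] [NormedSpace ℝ E]
    {f : E → ℝ} (hf : Differentiable ℝ f) (c x v : E) :
    fderiv ℝ (fun y => f (c - y)) x v = -fderiv ℝ f (c - x) v := by
  have h : HasFDerivAt (fun y => c - y) (-ContinuousLinearMap.id ℝ E) x :=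
    (hasFDerivAt_id x).const_sub c
  have := ((hf (c - x)).hasFDerivAt.comp x h).fderiv
  simp only [Function.comp_def] at this
  rw [this]
  simp

theorem laplacian_comp_const_sub {n : ℕ} {f : EuclideanSpace ℝ (Fin n) → ℝ}
    (hf : ContDiff ℝ 2 f) (c x : EuclideanSpace ℝ (Fin n)) :
    laplacian (fun y => f (c - y)) x = laplacian f (c - x) := by
  have h2 : ContDiff ℝ 2 fun y => f (c - y) := hf.comp (contDiff_const.sub contDiff_id)
  rw [laplacian_eq_sum_fderiv_fderiv_apply h2, laplacian_eq_sum_fderiv_fderiv_apply hf]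
  refine Finset.sum_congr rfl fun i _ => ?_
  have h1 : Differentiable ℝ fun y => fderiv ℝ f y (EuclideanSpace.single i 1) :=
    ((hf.fderiv_right (m := 1) (by norm_num)).differentiable one_ne_zero).clm_apply
      (differentiable_const _)
  simp_rw [fderiv_comp_const_sub_apply (hf.differentiable two_ne_zero), fderiv_fun_neg,
    neg_apply, fderiv_comp_const_sub_apply h1, neg_neg]

theorem laplacian_convolution_lsmul {n : ℕ} {k g : EuclideanSpace ℝ (Fin n) → ℝ}
    (hk : ContDiff ℝ 2 k) (hck : HasCompactSupport k) (hg : LocallyIntegrable g)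
    (x : EuclideanSpace ℝ (Fin n)) :
    laplacian (k ⋆[ContinuousLinearMap.lsmul ℝ ℝ] g : EuclideanSpace ℝ (Fin n) → ℝ) x =
      ∫ y, g y * laplacian (fun z => k (x - z)) y := by
  have hk1 : ContDiff ℝ 1 k := hk.of_le one_le_two
  have hd (i : Fin n) : ContDiff ℝ 1 fun y => fderiv ℝ k y (EuclideanSpace.single i 1) :=
    (hk.fderiv_right (m := 1) (by norm_num)).clm_apply contDiff_const
  have hcd (i : Fin n) := hck.fderiv_apply (𝕜 := ℝ) (EuclideanSpace.single i (1 : ℝ))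
  rw [laplacian_eq_sum_fderiv_fderiv_apply
    (hck.contDiff_convolution_left _ hk hg)]
  simp_rw [fderiv_convolution_lsmul_apply hk1 hck hg,
    fderiv_convolution_lsmul_apply (hd _) (hcd _) hg, convolution_lsmul_swap,
    laplacian_comp_const_sub hk, laplacian_eq_sum_fderiv_fderiv_apply hk]
  rw [← integral_finsetSum]
  · simp only [smul_eq_mul, Finset.mul_sum, mul_comm]
  · intro i _
    have := ((hcd i).fderiv_apply (𝕜 := ℝ) (EuclideanSpace.single i (1 : ℝ))).convolutionExists_left
      (ContinuousLinearMap.lsmul ℝ ℝ)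
      (((hd i).continuous_fderiv one_ne_zero).clm_apply continuous_const) hg x
    exact this.integrable_swap

/-- A function with nonnegative Laplacian, minus a strictly superharmonic logarithmic
barrier in the first two variables, has no local maximum off the axis. -/
theorem not_isLocalMax_sub_log_barrier {f : EuclideanSpace ℝ (Fin 3) → ℝ} (hf : ContDiff ℝ 2 f)
    {x : EuclideanSpace ℝ (Fin 3)} (hx : 0 < x 0 ^ 2 + x 1 ^ 2) (hlap : 0 ≤ laplacian f x)
    {δ : ℝ} (hδ : 0 < δ) (C : ℝ) :
    ¬ IsLocalMax (fun y : EuclideanSpace ℝ (Fin 3) =>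
      f y - δ * (C - Real.log (y 0 ^ 2 + y 1 ^ 2) - (y 0 ^ 2 + y 1 ^ 2))) x := by
  intro hmax
  set F := fun y : EuclideanSpace ℝ (Fin 3) =>
      f y - δ * (C - Real.log (y 0 ^ 2 + y 1 ^ 2) - (y 0 ^ 2 + y 1 ^ 2)) with hF
  have hline (i : Fin 3) (t : ℝ) : HasDerivAt (fun t : ℝ => x + t • EuclideanSpace.single i (1 : ℝ))
      (EuclideanSpace.single i (1 : ℝ)) t := by
    simpa using ((hasDerivAt_id t).smul_const (EuclideanSpace.single i (1 : ℝ))).const_add x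
  have hd (i : Fin 3) : ContDiff ℝ 1 fun y => fderiv ℝ f y (EuclideanSpace.single i 1) :=
    (hf.fderiv_right (m := 1) (by norm_num)).clm_apply contDiff_const
  have hf1 (i : Fin 3) (t : ℝ) :
      HasDerivAt (fun t : ℝ => f (x + t • EuclideanSpace.single i (1 : ℝ)))
        (fderiv ℝ f (x + t • EuclideanSpace.single i (1 : ℝ)) (EuclideanSpace.single i 1)) t :=
    (hf.differentiable two_ne_zero _).hasFDerivAt.comp_hasDerivAt t (hline i t)
  have hf2 (i : Fin 3) := (((hd i).differentiable one_ne_zero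
    (x + (0 : ℝ) • EuclideanSpace.single i (1 : ℝ))).hasFDerivAt.comp_hasDerivAt 0 (hline i 0))
  have hm (i : Fin 3) : IsLocalMax (fun t : ℝ => F (x + t • EuclideanSpace.single i (1 : ℝ))) 0 := by
    have h0 : Filter.Tendsto (fun t : ℝ => x + t • EuclideanSpace.single i (1 : ℝ)) (nhds 0)
        (nhds x) := by simpa using (hline i 0).continuousAt.tendsto
    simpa [IsLocalMax, IsMaxFilter] using h0.eventually hmax
  have key (a b : ℝ) (hab : 0 < a ^ 2 + b ^ 2) {h h' : ℝ → ℝ} {c : ℝ}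
      (h1 : ∀ t, HasDerivAt h (h' t) t) (h2 : HasDerivAt h' c 0)
      (hloc : IsLocalMax (fun t => h t - δ * (C - Real.log ((a + t) ^ 2 + b ^ 2)
        - ((a + t) ^ 2 + b ^ 2))) 0) :
      c + δ * (2 / (a ^ 2 + b ^ 2) - 4 * a ^ 2 / (a ^ 2 + b ^ 2) ^ 2 + 2) ≤ 0 := by
    have hu (t : ℝ) : HasDerivAt (fun t : ℝ => (a + t) ^ 2 + b ^ 2) (2 * (a + t)) t := by
      simpa using (((hasDerivAt_id t).const_add a).pow 2).add_const (b ^ 2)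
    have hu' : HasDerivAt (fun t : ℝ => 2 * (a + t)) 2 0 := by
      simpa using ((hasDerivAt_id (0 : ℝ)).const_add a).const_mul 2
    refine nonpos_of_isLocalMax_of_hasDerivAt
      (h' := fun t => h' t + δ * (2 * (a + t) / ((a + t) ^ 2 + b ^ 2) + 2 * (a + t))) ?_ ?_ hloc
    · have : ∀ᶠ t in nhds (0 : ℝ), 0 < (a + t) ^ 2 + b ^ 2 :=
        (hu 0).continuousAt.eventually (lt_mem_nhds (by simpa using hab))
      filter_upwards [this] with t ht
      convert! (h1 t).sub (((((hu t).log ht.ne').const_sub C).sub (hu t)).const_mul δ) using 1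
      ring
    · convert! h2.add (((hu'.div (hu 0) (by simpa using hab.ne')).add hu').const_mul δ) using 1
      simp only [add_zero]
      field_simp
      ring
  have k0 := key (x 0) (x 1) hx (hf1 0) (hf2 0) (by simpa [hF] using hm 0)
  have k1 := key (x 1) (x 0) (by rwa [add_comm]) (hf1 1) (hf2 1)
    (by simpa [hF, add_comm] using hm 1)
  have k2 := nonpos_of_isLocalMax_of_hasDerivAt (.of_forall fun t => (hf1 2 t).sub_const _) (hf2 2)
    (by simpa [hF] using hm 2)
  rw [laplacian_eq_sum_fderiv_fderiv_apply hf, Fin.sum_univ_three] at hlap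
  simp only [zero_smul, add_zero] at k0 k1 k2
  rw [add_comm (x 1 ^ 2)] at k1
  have : δ * (2 / (x 0 ^ 2 + x 1 ^ 2) - 4 * x 0 ^ 2 / (x 0 ^ 2 + x 1 ^ 2) ^ 2 + 2) +
    δ * (2 / (x 0 ^ 2 + x 1 ^ 2) - 4 * x 1 ^ 2 / (x 0 ^ 2 + x 1 ^ 2) ^ 2 + 2) = 4 * δ := by
    field_simp
    ring
  linarith

/-- Comparison with the logarithmic barrier for a smooth function that is subharmonic away from
the axis. -/
theorem le_add_log_barrier {f : EuclideanSpace ℝ (Fin 3) → ℝ} (hf : ContDiff ℝ 2 f)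
    {s R M η δ C : ℝ} (hs : 0 < s) (hδ : 0 < δ)
    (hlap : ∀ x, s < x 0 ^ 2 + x 1 ^ 2 → 0 ≤ laplacian f x)
    (hM : ∀ x, f x ≤ M) (hR : ∀ x, ‖x‖ = R → f x ≤ η)
    (hC : Real.log (R ^ 2) + R ^ 2 ≤ C) (hMs : M ≤ η + δ * (C - Real.log s - s))
    {p : EuclideanSpace ℝ (Fin 3)} (hp : s ≤ p 0 ^ 2 + p 1 ^ 2) (hpR : ‖p‖ ≤ R) :
    f p ≤ η + δ * (C - Real.log (p 0 ^ 2 + p 1 ^ 2) - (p 0 ^ 2 + p 1 ^ 2)) := by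
  set u : EuclideanSpace ℝ (Fin 3) → ℝ := fun y => y 0 ^ 2 + y 1 ^ 2 with hu
  have huc : Continuous u := by fun_prop
  set F : EuclideanSpace ℝ (Fin 3) → ℝ := fun y => f y - δ * (C - Real.log (u y) - u y) with hF
  set K : Set (EuclideanSpace ℝ (Fin 3)) := Metric.closedBall 0 R ∩ {y | s ≤ u y} with hK
  have hKc : IsCompact K :=
    (isCompact_closedBall 0 R).inter_right (isClosed_le continuous_const huc)
  have hFc : ContinuousOn F K := by
    have : ContinuousOn (fun y => Real.log (u y)) K :=
      huc.continuousOn.log fun y hy => (hs.trans_le hy.2).ne'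
    have := hf.continuous
    fun_prop
  have hpK : p ∈ K := ⟨by simpa using hpR, hp⟩
  obtain ⟨x, hxK, hx⟩ := hKc.exists_isMaxOn ⟨p, hpK⟩ hFc
  suffices F x ≤ η by
    have := (hx hpK).trans this
    simp only [hF] at this
    linarith
  by_contra! hlt
  have hxs : s ≤ u x := hxK.2
  have hxR : ‖x‖ ≤ R := by simpa using hxK.1
  have huR : u x ≤ R ^ 2 := by
    have h1 : u x ≤ ‖x‖ ^ 2 := by
      rw [EuclideanSpace.real_norm_sq_eq, Fin.sum_univ_three]
      exact le_add_of_nonneg_right (sq_nonneg _)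
    exact h1.trans (pow_le_pow_left₀ (norm_nonneg _) hxR 2)
  have hG : 0 ≤ C - Real.log (u x) - u x := by
    have := Real.log_le_log (hs.trans_le hxs) huR
    linarith
  have hxs' : s < u x := by
    refine hxs.lt_of_ne fun h => ?_
    simp only [hF, ← h] at hlt
    linarith [hM x]
  have hxR' : ‖x‖ < R := by
    refine hxR.lt_of_ne fun h => ?_
    simp only [hF] at hlt
    linarith [hR x h, mul_nonneg hδ.le hG]
  refine not_isLocalMax_sub_log_barrier hf (hs.trans hxs') (hlap x hxs') hδ C ?_
  refine hx.isLocalMax ?_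
  filter_upwards [Metric.isOpen_ball.mem_nhds (by simpa using hxR' : x ∈ Metric.ball 0 R),
    huc.continuousAt.eventually (lt_mem_nhds hxs')] with y h1 h2
  exact ⟨Metric.ball_subset_closedBall h1, le_of_lt h2⟩

/-- The logarithmic barrier exceeds any bound close to the axis. -/
theorem exists_pos_le_log_barrier {δ : ℝ} (hδ : 0 < δ) (M η C a : ℝ) (ha : 0 < a) :
    ∃ s, 0 < s ∧ s ≤ a ∧ M ≤ η + δ * (C - Real.log s - s) := by
  have h1 : Filter.Tendsto (fun s => C - Real.log s - s) (nhdsWithin 0 (Set.Ioi 0)) Filter.atTop := by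
    have h2 : Filter.Tendsto (fun s : ℝ => C - s) (nhdsWithin 0 (Set.Ioi 0)) (nhds (C - 0)) :=
      (tendsto_const_nhds.sub Filter.tendsto_id).mono_left nhdsWithin_le_nhds
    have h3 := h2.add_atTop (Filter.tendsto_neg_atBot_atTop.comp Real.tendsto_log_nhdsGT_zero)
    refine h3.congr fun s => ?_
    simp only [Function.comp_apply]; ring
  have h4 := h1.eventually_ge_atTop ((M - η) / δ)
  obtain ⟨s, h5, h6, h7⟩ := (h4.and (Ioc_mem_nhdsGT ha)).exists
  refine ⟨s, h6, h7, ?_⟩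
  rw [div_le_iff₀' hδ] at h5
  linarith

/-- Weinstein's lemma: a bounded nonnegative function on the complement of the
`z`-axis in ℝ³, continuous there, decaying at infinity, and distributionally
subharmonic there, vanishes identically. -/
theorem weinstein_lemma
    (L : Set (EuclideanSpace ℝ (Fin 3)))
    (hL : L = {p : EuclideanSpace ℝ (Fin 3) | p 0 = 0 ∧ p 1 = 0})
    (Ω : Set (EuclideanSpace ℝ (Fin 3)))
    (hΩ : Ω = Lᶜ)
    (σ : EuclideanSpace ℝ (Fin 3) → ℝ)
    (hcont : ContinuousOn σ Ω)
    (M : ℝ)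
    (hnonneg : ∀ p ∈ Ω, 0 ≤ σ p)
    (hbdd : ∀ p ∈ Ω, σ p ≤ M)
    (hdecay : Filter.Tendsto σ (Filter.cocompact (EuclideanSpace ℝ (Fin 3))) (nhds 0))
    (hsubharm : ∀ φ : EuclideanSpace ℝ (Fin 3) → ℝ,
      ContDiff ℝ (⊤ : ℕ∞) φ → HasCompactSupport φ → tsupport φ ⊆ Ω → (∀ p, 0 ≤ φ p) →
      0 ≤ ∫ p, σ p * laplacian φ p) :
    ∀ p ∈ Ω, σ p = 0 := by
  intro p hp
  have hmem (x : EuclideanSpace ℝ (Fin 3)) : x ∈ Ω ↔ 0 < x 0 ^ 2 + x 1 ^ 2 := by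
    rw [hΩ, hL, Set.mem_compl_iff, Set.mem_ofPred_eq, not_iff_comm, not_lt]
    constructor
    · intro h
      constructor <;> nlinarith [sq_nonneg (x 0), sq_nonneg (x 1)]
    · rintro ⟨h0, h1⟩
      simp [h0, h1]
  have hΩo : IsOpen Ω := by
    have : Ω = {x | 0 < x 0 ^ 2 + x 1 ^ 2} := Set.ext hmem
    rw [this]
    exact isOpen_lt continuous_const (by fun_prop)
  set g : EuclideanSpace ℝ (Fin 3) → ℝ := Ω.indicator σ with hg
  have hM : 0 ≤ M := (hnonneg p hp).trans (hbdd p hp)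
  have hg0 (x) : 0 ≤ g x := Set.indicator_nonneg hnonneg x
  have hgM (x) : g x ≤ M := Set.indicator_le' hbdd (fun _ _ => hM) x
  have hgm : AEStronglyMeasurable g :=
    (aestronglyMeasurable_indicator_iff hΩo.measurableSet).2
      (hcont.aestronglyMeasurable hΩo.measurableSet)
  have hgl : LocallyIntegrable g := by
    refine (locallyIntegrable_const M).mono hgm (.of_forall fun x => ?_)
    rw [Real.norm_of_nonneg (hg0 x), Real.norm_of_nonneg hM]
    exact hgM x
  have hgc : ContinuousAt g p :=
    (hcont.continuousAt (hΩo.mem_nhds hp)).congr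
      ((Set.eqOn_indicator.eventuallyEq_of_mem (hΩo.mem_nhds hp)).symm)
  have hgp : g p = σ p := Set.indicator_of_mem hp σ
  rw [← hgp]
  refine le_antisymm (le_of_forall_pos_le_add fun η' hη' => ?_) (hg0 p)
  obtain ⟨η, hη, rfl⟩ : ∃ η, 0 < η ∧ η' = 3 * η := ⟨η' / 3, by positivity, by ring⟩
  obtain ⟨R₀, hR₀⟩ : ∃ R₀, ∀ x, R₀ < ‖x‖ → g x ≤ η := by
    obtain ⟨K, hK, hKη⟩ := Filter.mem_cocompact.1 (hdecay.eventually (gt_mem_nhds hη))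
    obtain ⟨R₀, hR₀⟩ := hK.isBounded.subset_closedBall 0
    refine ⟨R₀, fun x hx => ?_⟩
    have : σ x < η := hKη fun h => hx.not_ge (by simpa using hR₀ h)
    exact Set.indicator_apply_le' (fun _ => this.le) fun _ => hη.le
  set R := max (R₀ + 1) ‖p‖
  set C := Real.log (R ^ 2) + R ^ 2
  set G := C - Real.log (p 0 ^ 2 + p 1 ^ 2) - (p 0 ^ 2 + p 1 ^ 2)
  have hG : 0 < |G| + 1 := by positivity
  set δ := η / (|G| + 1)
  have hδ : 0 < δ := div_pos hη hG
  have hδG : δ * G ≤ η := by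
    calc δ * G ≤ δ * (|G| + 1) := by gcongr; linarith [le_abs_self G]
      _ = η := div_mul_cancel₀ _ hG.ne'
  obtain ⟨s, hs, hsp, hsM⟩ := exists_pos_le_log_barrier hδ M η C _ ((hmem p).1 hp)
  obtain ⟨r, hr, hrp⟩ := Metric.continuousAt_iff.1 hgc η hη
  obtain ⟨ε, hε, hεr⟩ : ∃ ε, 0 < ε ∧ ε ≤ r ∧ ε ≤ 1 ∧ ε ^ 2 ≤ s := by
    refine ⟨min r (min 1 √s), by positivity, min_le_left _ _,
      (min_le_right _ _).trans (min_le_left _ _), ?_⟩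
    calc _ ≤ √s ^ 2 := by gcongr; exact (min_le_right _ _).trans (min_le_right _ _)
      _ = s := Real.sq_sqrt hs.le
  obtain ⟨hεr, hε1, hεs⟩ := hεr
  let b : ContDiffBump (0 : EuclideanSpace ℝ (Fin 3)) := ⟨ε / 2, ε, by positivity, by linarith⟩
  set k := b.normed volume
  have hk (n : ℕ∞) : ContDiff ℝ n k := b.contDiff_normed
  have hck : HasCompactSupport k := b.hasCompactSupport_normed
  have hk0 (x) : 0 ≤ k x := b.nonneg_normed x
  have hsupp : Function.support k ⊆ Metric.ball 0 ε := b.support_normed_eq.subset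
  set f : EuclideanSpace ℝ (Fin 3) → ℝ := k ⋆[ContinuousLinearMap.lsmul ℝ ℝ] g
  have hdist {x z c} (hc : 0 ≤ c) (h : ∀ y ∈ Metric.ball x ε, dist (g y) z ≤ c) :
      dist (f x) z ≤ c :=
    dist_convolution_le hc hsupp hk0 b.integral_normed hgm h
  have hfle {x c} (hc : 0 ≤ c) (h : ∀ y ∈ Metric.ball x ε, g y ≤ c) : f x ≤ c := by
    have := hdist (x := x) (z := 0) hc fun y hy => by
      rw [Real.dist_0_eq_abs, abs_of_nonneg (hg0 y)]; exact h y hy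
    rw [Real.dist_0_eq_abs] at this
    exact (le_abs_self _).trans this
  have hfp : g p ≤ f p + η := by
    have := hdist (x := p) (z := g p) hη.le fun y hy => (hrp (hy.trans_le hεr)).le
    rw [Real.dist_eq, abs_le] at this
    linarith
  have hlap (x : EuclideanSpace ℝ (Fin 3)) (hx : s < x 0 ^ 2 + x 1 ^ 2) : 0 ≤ laplacian f x := by
    rw [laplacian_convolution_lsmul (hk 2) hck hgl]
    have hφ : ContDiff ℝ (⊤ : ℕ∞) fun z => k (x - z) := (hk _).comp (contDiff_const.sub contDiff_id)
    have hts : tsupport (fun z => k (x - z)) ⊆ Metric.closedBall x ε := by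
      refine closure_minimal (fun z hz => ?_) Metric.isClosed_closedBall
      have := hsupp (a := x - z) hz
      rw [mem_ball_zero_iff] at this
      rw [Metric.mem_closedBall, dist_comm, dist_eq_norm]
      exact this.le
    have htΩ : tsupport (fun z => k (x - z)) ⊆ Ω := by
      intro y hy
      rw [hmem]
      by_contra! h
      have h0 : y 0 = 0 := by nlinarith [sq_nonneg (y 0), sq_nonneg (y 1)]
      have h1 : y 1 = 0 := by nlinarith [sq_nonneg (y 0), sq_nonneg (y 1)]
      have h2 : ‖x - y‖ ≤ ε := by
        have := hts hy
        rwa [Metric.mem_closedBall, dist_comm, dist_eq_norm] at this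
      have h3 : ‖x - y‖ ^ 2 ≤ ε ^ 2 := pow_le_pow_left₀ (norm_nonneg _) h2 2
      rw [EuclideanSpace.real_norm_sq_eq, Fin.sum_univ_three] at h3
      simp only [PiLp.sub_apply, h0, h1, sub_zero] at h3
      linarith [sq_nonneg (x 2 - y 2)]
    refine (hsubharm _ hφ (.of_support_subset_isCompact (isCompact_closedBall x ε)
      ((subset_tsupport _).trans hts)) htΩ fun _ => hk0 _).trans_eq ?_
    congr 1
    ext y
    by_cases hy : y ∈ Ω
    · rw [hg, Set.indicator_of_mem hy]
    · have : fderiv ℝ (fderiv ℝ fun z => k (x - z)) y = 0 :=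
        image_eq_zero_of_notMem_tsupport fun h =>
          hy (htΩ (tsupport_fderiv_subset ℝ (tsupport_fderiv_subset ℝ h)))
      simp [laplacian, this]
  have hfin := le_add_log_barrier (f := f) (R := R)
    (hck.contDiff_convolution_left (n := 2) _ (hk 2) hgl) hs hδ hlap
    (fun x => hfle hM fun y _ => hgM y)
    (fun x hx => hfle hη.le fun y hy => hR₀ y ?_) le_rfl hsM hsp (le_max_right _ _)
  · linarith
  · have h1 : ‖x‖ - ‖y‖ ≤ ‖x - y‖ := norm_sub_norm_le _ _
    have h2 : ‖x - y‖ < ε := by rwa [Metric.mem_ball, dist_comm, dist_eq_norm] at hy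
    have h3 : R₀ + 1 ≤ R := le_max_left _ _
    linarith
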